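/- arXiv:2001.04857 — 2 statements merged into one kernel-verified Lean document; each statement's English description precedes it below -/
import Mathlib

section
/- Let X be an infinite, connected, vertex-transitive, uniformly locally finite graph, with 2-simplices its triangles. If every element of Z^suf_1(X,ℤ) is the boundary of a bounded 2-chain (i.e., H^suf_1(X,ℤ) = 0), then X has H^suf_1-expansion. -/
open scoped Classical

namespace UFH

variable {V : Type}

/-- Uniform local finiteness: a uniform bound on vertex degrees. -/
def ULF (G : SimpleGraph V) : Prop :=
  ∃ D : ℕ, ∀ v : V, (G.neighborSet v).Finite ∧ (G.neighborSet v).ncard ≤ D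

/-- An integer 1-chain: antisymmetric and supported on adjacent pairs. -/
def IsChain1 (G : SimpleGraph V) (f : V → V → ℤ) : Prop :=
  (∀ u v, f u v = - f v u) ∧ ∀ u v, f u v ≠ 0 → G.Adj u v

/-- A mod-2 1-chain: symmetric and supported on adjacent pairs. -/
def IsChain1Z2 (G : SimpleGraph V) (f : V → V → ZMod 2) : Prop :=
  (∀ u v, f u v = f v u) ∧ ∀ u v, f u v ≠ 0 → G.Adj u v

/-- Divergence of an integer 1-chain at a vertex. -/
noncomputable def chainDiv (f : V → V → ℤ) (v : V) : ℤ := ∑ᶠ u, f u v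

/-- Divergence of a mod-2 1-chain at a vertex. -/
noncomputable def chainDivZ2 (f : V → V → ZMod 2) (v : V) : ZMod 2 := ∑ᶠ u, f u v

def Bdd (f : V → V → ℤ) (C : ℕ) : Prop := ∀ u v, |f u v| ≤ (C : ℤ)

/-- The sup-norm of a bounded integer 1-chain (least uniform bound). -/
noncomputable def chainNorm (f : V → V → ℤ) : ℕ := sInf {C : ℕ | Bdd f C}

/-- Bounded integer flows: bounded 1-chains with vanishing divergence everywhere. -/
def Zsuf1 (G : SimpleGraph V) : Set (V → V → ℤ) :=
  {f | IsChain1 G f ∧ (∃ C, Bdd f C) ∧ ∀ v, chainDiv f v = 0}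

/-- Mod-2 cycles: mod-2 1-chains whose support meets every vertex evenly. -/
def Zsuf1Z2 (G : SimpleGraph V) : Set (V → V → ZMod 2) :=
  {f | IsChain1Z2 G f ∧ ∀ v, chainDivZ2 f v = 0}

/-- A circuit: a closed walk (based at some vertex). -/
abbrev Circuit (G : SimpleGraph V) := Σ v : V, G.Walk v v

/-- Number of traversals of the oriented edge `(a, b)` by the walk `p`. -/
noncomputable def traversals {G : SimpleGraph V} {u v : V} (p : G.Walk u v) (a b : V) : ℕ :=
  ((Finset.range p.length).filter fun i => p.getVert i = a ∧ p.getVert (i + 1) = b).card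

/-- The integer 1-chain of signed traversals of a walk. -/
noncomputable def walkChain {G : SimpleGraph V} {u v : V} (p : G.Walk u v) (a b : V) : ℤ :=
  (traversals p a b : ℤ) - (traversals p b a : ℤ)

/-- The mod-2 1-chain of traversals of a walk. -/
noncomputable def walkChainZ2 {G : SimpleGraph V} {u v : V} (p : G.Walk u v) (a b : V) : ZMod 2 :=
  (traversals p a b : ZMod 2) + (traversals p b a : ZMod 2)

/-- The walk `p` passes through the edge `{a, b}`. -/
def OnWalk {G : SimpleGraph V} {u v : V} (p : G.Walk u v) (a b : V) : Prop :=
  ∃ i < p.length, (p.getVert i = a ∧ p.getVert (i + 1) = b) ∨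
    (p.getVert i = b ∧ p.getVert (i + 1) = a)

/-- A coefficient family on circuits is thin (locally finite). -/
def ThinCoef (G : SimpleGraph V) (g : Circuit G → ℤ) : Prop :=
  ∀ a b : V, {c : Circuit G | g c ≠ 0 ∧ OnWalk c.2 a b}.Finite

def ThinCoefZ2 (G : SimpleGraph V) (g : Circuit G → ZMod 2) : Prop :=
  ∀ a b : V, {c : Circuit G | g c ≠ 0 ∧ OnWalk c.2 a b}.Finite

/-- The 1-chain obtained as the (pointwise) sum of a family of circuits with coefficients. -/
noncomputable def circSum (G : SimpleGraph V) (g : Circuit G → ℤ) : V → V → ℤ :=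
  fun a b => ∑ᶠ c : Circuit G, g c * walkChain c.2 a b

noncomputable def circSumZ2 (G : SimpleGraph V) (g : Circuit G → ZMod 2) : V → V → ZMod 2 :=
  fun a b => ∑ᶠ c : Circuit G, g c * walkChainZ2 c.2 a b

/-- 𝒞_r(X, ℤ): sums of circuits of length ≤ r with uniformly bounded integer coefficients. -/
def Cr (G : SimpleGraph V) (r : ℕ) : Set (V → V → ℤ) :=
  {f | ∃ g : Circuit G → ℤ, (∃ C : ℕ, ∀ c, |g c| ≤ (C : ℤ)) ∧
    (∀ c, g c ≠ 0 → c.2.length ≤ r) ∧ ThinCoef G g ∧ f = circSum G g}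

/-- 𝒞_∞(X, ℤ). -/
def Cinf (G : SimpleGraph V) : Set (V → V → ℤ) := ⋃ r : ℕ, Cr G r

/-- 𝒞(X, ℤ): thin sums of circuits with integer coefficients whose result is bounded. -/
def Cthin (G : SimpleGraph V) : Set (V → V → ℤ) :=
  {f | ∃ g : Circuit G → ℤ, ThinCoef G g ∧ (∃ C, Bdd f C) ∧ f = circSum G g}

/-- 𝒞_r(X, ℤ₂). -/
def CrZ2 (G : SimpleGraph V) (r : ℕ) : Set (V → V → ZMod 2) :=
  {f | ∃ g : Circuit G → ZMod 2, (∀ c, g c ≠ 0 → c.2.length ≤ r) ∧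
    ThinCoefZ2 G g ∧ f = circSumZ2 G g}

/-- 𝒞_∞(X, ℤ₂). -/
def CinfZ2 (G : SimpleGraph V) : Set (V → V → ZMod 2) := ⋃ r : ℕ, CrZ2 G r

/-- 𝒞(X, ℤ₂): thin sums of circuits mod 2. -/
def CthinZ2 (G : SimpleGraph V) : Set (V → V → ZMod 2) :=
  {f | ∃ g : Circuit G → ZMod 2, ThinCoefZ2 G g ∧ f = circSumZ2 G g}

/-- `a` and `b` are joined by a walk avoiding the set `K`. -/
def ConnAvoiding (G : SimpleGraph V) (K : Set V) (a b : V) : Prop :=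
  ∃ p : G.Walk a b, ∀ v ∈ p.support, v ∉ K

/-- A (one-sided infinite) ray in `G`. -/
def IsRay (G : SimpleGraph V) (x : ℕ → V) : Prop :=
  Function.Injective x ∧ ∀ n, G.Adj (x n) (x (n + 1))

/-- Two rays determine the same end. -/
def RayEquiv (G : SimpleGraph V) (x y : ℕ → V) : Prop :=
  ∀ K : Finset V, ∃ N, ∀ n, N ≤ n → ∀ m, N ≤ m → ConnAvoiding G (↑K) (x n) (y m)

/-- The connected component of `v` in `X − K`. -/
def Component (G : SimpleGraph V) (K : Set V) (v : V) : Set V :=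
  {u | u ∉ K ∧ ConnAvoiding G K u v}

def MoreThanOneEnd (G : SimpleGraph V) : Prop :=
  ∃ K : Finset V, ∃ v w : V, v ∉ K ∧ w ∉ K ∧ (Component G (↑K) v).Infinite ∧
    (Component G (↑K) w).Infinite ∧ ¬ ConnAvoiding G (↑K) v w

def OneEnded (G : SimpleGraph V) : Prop :=
  Infinite V ∧ ∀ K : Finset V, ∃ v, v ∉ K ∧ (Component G (↑K) v).Infinite ∧
    ∀ u, u ∉ K → (Component G (↑K) u).Infinite → ConnAvoiding G (↑K) u v

/-- A bip: a bi-infinite path, i.e. injective graph morphism ℤ → T. -/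
def IsBip (T : SimpleGraph V) (b : ℤ → V) : Prop :=
  Function.Injective b ∧ ∀ n : ℤ, T.Adj (b n) (b (n + 1))

/-- The bip `b` lies over the edge `{u, v}`. -/
def LiesOver (b : ℤ → V) (u v : V) : Prop :=
  ∃ n : ℤ, (b n = u ∧ b (n + 1) = v) ∨ (b n = v ∧ b (n + 1) = u)

/-- The signed traversal of the oriented edge `(u, v)` by the bip `b`. -/
noncomputable def bipSign (b : ℤ → V) (u v : V) : ℤ :=
  if ∃ n : ℤ, b n = u ∧ b (n + 1) = v then 1
  else if ∃ n : ℤ, b n = v ∧ b (n + 1) = u then -1 else 0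

noncomputable def bipOverZ2 (b : ℤ → V) (u v : V) : ZMod 2 :=
  if LiesOver b u v then 1 else 0

/-- `p` is the last bip of `P` (w.r.t. the order `r`) lying over the edge `{u, v}`. -/
def IsLast (P : Set (ℤ → V)) (r : (ℤ → V) → (ℤ → V) → Prop) (p : ℤ → V) (u v : V) : Prop :=
  LiesOver p u v ∧ ∀ q ∈ P, q ≠ p → LiesOver q u v → r q p

/-- The 1-chain associated to coefficients on a family of bips. -/
noncomputable def bipMap (P : Set (ℤ → V)) (f : ↥P → ℤ) : V → V → ℤ :=
  fun u v => ∑ᶠ p : ↥P, f p * bipSign p.1 u v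

noncomputable def bipMapZ2 (P : Set (ℤ → V)) (f : ↥P → ZMod 2) : V → V → ZMod 2 :=
  fun u v => ∑ᶠ p : ↥P, f p * bipOverZ2 p.1 u v

/-- The set `S` is connected in the graph `H` (walks staying inside `S`). -/
def ConnectedIn (H : SimpleGraph V) (S : Set V) : Prop :=
  ∀ a ∈ S, ∀ b ∈ S, ∃ p : H.Walk a b, ∀ v ∈ p.support, v ∈ S

/-- `T` is a subtree of `G`. -/
def IsSubtree (G T : SimpleGraph V) : Prop :=
  T ≤ G ∧ T.IsAcyclic ∧ T.support.Nonempty ∧ ConnectedIn T T.support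

/-- Every vertex of `T` has degree ≥ 2 in `T`. -/
def Leafless (T : SimpleGraph V) : Prop :=
  ∀ v ∈ T.support, ∃ u w : V, u ≠ w ∧ T.Adj v u ∧ T.Adj v w

/-- Distinct ends of `T` determine distinct ends of `G`. -/
def EndRespecting (G T : SimpleGraph V) : Prop :=
  ∀ x y : ℕ → V, IsRay T x → IsRay T y → RayEquiv G x y → RayEquiv T x y

/-- Every end of `G` is represented by a unique end of `T`. -/
def EndDefining (G T : SimpleGraph V) : Prop :=
  EndRespecting G T ∧ ∀ x : ℕ → V, IsRay G x → ∃ y : ℕ → V, IsRay T y ∧ RayEquiv G x y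

/-- The subtree `T` of `G` has separators. -/
def HasSeparators (G T : SimpleGraph V) : Prop :=
  ∃ K : ℕ → Finset V,
    (∀ n, K n ⊆ K (n + 1)) ∧
    (∀ v : V, ∃ n, v ∈ K n) ∧
    (∀ n, ConnectedIn G (↑(K n))) ∧
    (∀ n, ConnectedIn T (T.support ∩ ↑(K n))) ∧
    (∀ n, ∀ v : V, v ∉ K n → (Component G (↑(K n)) v).Infinite →
      ∃! e : V × V, T.Adj e.1 e.2 ∧ e.1 ∈ K n ∧ e.2 ∉ K n ∧
        e.2 ∈ Component G (↑(K n)) v) ∧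
    (∀ n, ∀ a b : V, T.Adj a b → a ∈ K n → b ∉ K n → (Component G (↑(K n)) b).Infinite)

/-- An integer 2-chain: alternating, supported on triangles. -/
def IsChain2 (G : SimpleGraph V) (g : V → V → V → ℤ) : Prop :=
  (∀ u v w, g u v w = - g v u w) ∧ (∀ u v w, g u v w = - g u w v) ∧
    ∀ u v w, g u v w ≠ 0 → G.Adj u v ∧ G.Adj v w ∧ G.Adj u w

def Bdd2 (g : V → V → V → ℤ) (C : ℕ) : Prop := ∀ u v w, |g u v w| ≤ (C : ℤ)

/-- The boundary of a 2-chain. -/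
noncomputable def bd2 (g : V → V → V → ℤ) : V → V → ℤ := fun u v => ∑ᶠ w, g u v w

/-- `H^suf_1`-expansion. -/
def HsufExp1 (G : SimpleGraph V) : Prop :=
  ∃ K : ℕ → ℕ, ∀ U : Finset V, ∀ f : V → V → ℤ,
    IsChain1 G f →
    (∀ u v, f u v ≠ 0 → u ∈ U ∧ v ∈ U) →
    (∀ v ∈ U, (∀ u, G.Adj u v → u ∈ U) → chainDiv f v = 0) →
    (∃ fh ∈ Zsuf1 G, (∀ u ∈ U, ∀ v ∈ U, fh u v = f u v) ∧ chainNorm fh = chainNorm f) →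
    ∃ g : V → V → V → ℤ, IsChain2 G g ∧ Bdd2 g (K (chainNorm f)) ∧
      ∀ u ∈ U, ∀ v ∈ U, bd2 g u v = f u v

/-- Pure `H^suf_1`-expansion. -/
def PureHsufExp1 (G : SimpleGraph V) : Prop :=
  ∃ K : ℕ → ℕ, ∀ U : Finset V, ∀ f : V → V → ℤ,
    IsChain1 G f →
    (∀ u v, f u v ≠ 0 → u ∈ U ∧ v ∈ U) →
    (∀ v ∈ U, (∀ u, G.Adj u v → u ∈ U) → chainDiv f v = 0) →
    (∃ fh : V → V → ℤ, IsChain1 G fh ∧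
        (∃ g2 : V → V → V → ℤ, IsChain2 G g2 ∧ (∃ C, Bdd2 g2 C) ∧ bd2 g2 = fh) ∧
        (∀ u ∈ U, ∀ v ∈ U, fh u v = f u v) ∧ chainNorm fh = chainNorm f) →
    ∃ g : V → V → V → ℤ, IsChain2 G g ∧ Bdd2 g (K (chainNorm f)) ∧
      ∀ u ∈ U, ∀ v ∈ U, bd2 g u v = f u v

/-- The Rips graph of radius `s`. -/
def rips (G : SimpleGraph V) (s : ℕ) : SimpleGraph V :=
  SimpleGraph.fromRel fun u v => G.dist u v ≤ s

/-- Pure `H^uf_1`-expansion: the Rips graphs eventually have pure `H^suf_1`-expansion. -/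
def PureHufExp1 (G : SimpleGraph V) : Prop := ∃ s₀ : ℕ, ∀ s, s₀ ≤ s → PureHsufExp1 (rips G s)

def VertexTransitive (G : SimpleGraph V) : Prop := ∀ u v : V, ∃ φ : G ≃g G, φ u = v

/-- The edge boundary of a finite set of vertices. -/
def edgeBoundary (G : SimpleGraph V) (U : Finset V) : Set (Sym2 V) :=
  {e | e ∈ G.edgeSet ∧ ∃ a b : V, e = s(a, b) ∧ a ∈ U ∧ b ∉ U}

/-- Mod-2 reduction of an integer 1-chain. -/
def mod2 (f : V → V → ℤ) : V → V → ZMod 2 := fun u v => ((f u v : ℤ) : ZMod 2)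

/-- Pointwise domination of 1-chains: `r` flows in the same direction as `φ`, no stronger. -/
def chainLE (r φ : V → V → ℤ) : Prop :=
  ∀ u v, (0 ≤ φ u v → 0 ≤ r u v ∧ r u v ≤ φ u v) ∧ (φ u v ≤ 0 → φ u v ≤ r u v ∧ r u v ≤ 0)

/-- A set of functions is locally finite (thin). -/
def ThinFamily {Y : Type} (F : Set (Y → ZMod 2)) : Prop := ∀ y : Y, {f ∈ F | f y ≠ 0}.Finite

/-- The pointwise sum of a (thin) set of functions. -/
noncomputable def thinSum {Y : Type} (F : Set (Y → ZMod 2)) : Y → ZMod 2 :=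
  fun y => ∑ᶠ f : ↥F, f.1 y

/-- A thin-sum space: a subspace closed under thin sums. -/
def IsThinSumSpace {Y : Type} (W : Set (Y → ZMod 2)) : Prop :=
  0 ∈ W ∧ (∀ f ∈ W, ∀ g ∈ W, f + g ∈ W) ∧ ∀ F ⊆ W, ThinFamily F → thinSum F ∈ W

/-- A thin-sum basis for a thin-sum space. -/
def IsThinSumBasis {Y : Type} (A W : Set (Y → ZMod 2)) : Prop :=
  A ⊆ W ∧ (∀ f ∈ W, ∃ F ⊆ A, ThinFamily F ∧ f = thinSum F) ∧
    ∀ F ⊆ A, ThinFamily F → F.Nonempty → thinSum F ≠ 0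

/-- The integer 1-chain of the single oriented edge `(a, b)`. -/
noncomputable def edgeChain (a b : V) : V → V → ℤ := fun u v =>
  (if u = a ∧ v = b then 1 else 0) - (if u = b ∧ v = a then 1 else 0)

/-- The unit mass at `a`. -/
noncomputable def unitMass (a : V) : V → ℤ := fun v => if v = a then 1 else 0

/-- Finitely supported 1-chains of sup-norm at most `k` that agree with `f` on `U`. -/
structure Admissible (G : SimpleGraph V) (k : ℕ) (U : Finset V) (f h : V → V → ℤ) : Prop where
  chain : IsChain1 G h
  bdd : Bdd h k
  finite_support : {p : V × V | h p.1 p.2 ≠ 0}.Finite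
  agree : ∀ u ∈ U, ∀ v ∈ U, h u v = f u v

/-- One more unit of flow may be sent from `u` to `v`. -/
def Residual (G : SimpleGraph V) (k : ℕ) (U : Finset V) (h : V → V → ℤ) (u v : V) : Prop :=
  G.Adj u v ∧ h u v < k ∧ ¬ (u ∈ U ∧ v ∈ U)

theorem bdd_chainNorm {f : V → V → ℤ} (hf : ∃ C, Bdd f C) : Bdd f (chainNorm f) :=
  Nat.sInf_mem (s := {C : ℕ | Bdd f C}) hf

theorem exists_bdd_of_finite_support {f : V → V → ℤ}
    (hf : {p : V × V | f p.1 p.2 ≠ 0}.Finite) : ∃ C, Bdd f C := by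
  refine ⟨∑ p ∈ hf.toFinset, (f p.1 p.2).natAbs, fun u v => ?_⟩
  by_cases h : f u v = 0
  · rw [h, abs_zero]; positivity
  · have := Finset.single_le_sum (f := fun p : V × V => (f p.1 p.2).natAbs)
      (fun _ _ => Nat.zero_le _) (hf.mem_toFinset.2 (show (u, v) ∈ {p : V × V | f p.1 p.2 ≠ 0} from h))
    rw [Int.abs_eq_natAbs]
    exact_mod_cast this

theorem edgeChain_antisymm (a b u v : V) : edgeChain a b u v = - edgeChain a b v u := by
  simp only [edgeChain, and_comm (a := v = a), and_comm (a := v = b)]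
  ring

theorem chainDiv_edgeChain (a b v : V) :
    chainDiv (edgeChain a b) v = unitMass b v - unitMass a v := by
  have h1 : ∀ c d : V, (∑ᶠ u, if u = c ∧ v = d then (1 : ℤ) else 0) = unitMass d v := by
    intro c d
    rw [finsum_eq_single _ c (fun u hu => by simp [hu])]
    simp [unitMass]
  have hfin : ∀ c d : V, (Function.support fun u => if u = c ∧ v = d then (1 : ℤ) else 0).Finite :=
    fun c d => (Set.finite_singleton c).subset fun u hu => by
      by_contra h
      exact hu (if_neg fun h' => h h'.1)
  simp only [chainDiv, edgeChain]
  rw [finsum_sub_distrib (hfin a b) (hfin b a), h1, h1]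

theorem chainDiv_add {f g : V → V → ℤ} (hf : {p : V × V | f p.1 p.2 ≠ 0}.Finite)
    (hg : {p : V × V | g p.1 p.2 ≠ 0}.Finite) (v : V) :
    chainDiv (fun a b => f a b + g a b) v = chainDiv f v + chainDiv g v :=
  finsum_add_distrib
    ((hf.image Prod.fst).subset fun u hu => ⟨(u, v), hu, rfl⟩)
    ((hg.image Prod.fst).subset fun u hu => ⟨(u, v), hu, rfl⟩)

theorem edgeChain_finite_support (a b : V) :
    {p : V × V | edgeChain a b p.1 p.2 ≠ 0}.Finite := by
  refine (Set.toFinite {(a, b), (b, a)}).subset ?_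
  rintro ⟨u, v⟩ h
  by_contra h'
  simp only [Set.mem_insert_iff, Set.mem_singleton_iff, Prod.mk.injEq, not_or] at h'
  exact h (by simp [edgeChain, h'.1, h'.2])

theorem Admissible.push {G : SimpleGraph V} {k : ℕ} {U : Finset V} {f h : V → V → ℤ}
    (hh : Admissible G k U f h) {a b : V} (hab : Residual G k U h a b) :
    Admissible G k U f (fun u v => h u v + edgeChain a b u v) := by
  obtain ⟨hadj, hlt, hU⟩ := hab
  have hne := hadj.ne
  refine ⟨⟨fun u v => ?_, fun u v huv => ?_⟩, fun u v => ?_, ?_, fun u hu v hv => ?_⟩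
  · beta_reduce
    rw [hh.chain.1 u v, edgeChain_antisymm]
    ring
  · by_contra hn
    have h0 : h u v = 0 := by_contra fun h0 => hn (hh.chain.2 u v h0)
    have h1 : ¬ (u = a ∧ v = b) := fun ⟨h1, h2⟩ => hn (h1 ▸ h2 ▸ hadj)
    have h2 : ¬ (u = b ∧ v = a) := fun ⟨h1, h2⟩ => hn (h1 ▸ h2 ▸ hadj.symm)
    exact huv (by simp [edgeChain, h0, h1, h2])
  · have hb := abs_le.1 (hh.bdd u v)
    have ha := hh.chain.1 a b
    rw [abs_le]
    by_cases h1 : u = a ∧ v = b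
    · obtain ⟨rfl, rfl⟩ := h1
      simp only [edgeChain, hne, false_and, and_self, if_true, if_false]
      omega
    · by_cases h2 : u = b ∧ v = a
      · obtain ⟨rfl, rfl⟩ := h2
        simp only [edgeChain, hne.symm, false_and, and_self, if_true, if_false]
        omega
      · simp only [edgeChain, h1, h2, if_false]
        omega
  · refine (hh.finite_support.union (edgeChain_finite_support a b)).subset fun p hp => ?_
    by_contra h'
    simp only [Set.mem_union, Set.mem_ofPred_eq, not_or, not_not] at h' hp
    exact hp (by rw [h'.1, h'.2, add_zero])
  · have h1 : ¬ (u = a ∧ v = b) := fun ⟨h1, h2⟩ => hU ⟨h1 ▸ hu, h2 ▸ hv⟩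
    have h2 : ¬ (u = b ∧ v = a) := fun ⟨h1, h2⟩ => hU ⟨h2 ▸ hv, h1 ▸ hu⟩
    simp [edgeChain, h1, h2, hh.agree u hu v hv]

/-- Augmentation along a simple residual path, listed from its end `y` back to its start `x`. -/
theorem Admissible.augment {G : SimpleGraph V} {k : ℕ} {U : Finset V} {f : V → V → ℤ} {x : V}
    (l : List V) : ∀ {h : V → V → ℤ}, Admissible G k U f h → ∀ {y : V},
      (y :: l).IsChain (fun a b => Residual G k U h b a) → (y :: l).Nodup →
      (y :: l).getLast? = some x →
      ∃ h', Admissible G k U f h' ∧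
        ∀ v, chainDiv h' v = chainDiv h v + unitMass y v - unitMass x v := by
  induction l with
  | nil =>
    intro h hh y _ _ hx
    obtain rfl : y = x := by simpa using hx
    exact ⟨h, hh, fun v => by ring⟩
  | cons z l ih =>
    intro h hh y hc hnd hx
    rw [List.isChain_cons_cons] at hc
    have hy := (List.nodup_cons.1 hnd).1
    have hc' : (z :: l).IsChain
        (fun a b => Residual G k U (fun u v => h u v + edgeChain z y u v) b a) := by
      refine hc.2.imp_of_mem_imp fun a b ha hb hab => ?_
      have hay : a ≠ y := fun h => hy (h ▸ ha)
      have hby : b ≠ y := fun h => hy (h ▸ hb)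
      simpa [Residual, edgeChain, hay, hby] using hab
    obtain ⟨h', hh', hdiv⟩ := ih (hh.push hc.1) hc' (List.nodup_cons.1 hnd).2 (by simpa using hx)
    refine ⟨h', hh', fun v => ?_⟩
    rw [hdiv, chainDiv_add hh.finite_support (edgeChain_finite_support z y), chainDiv_edgeChain]
    ring

/-- A reachable point is reached along a simple path (listed backwards). -/
theorem exists_nodup_chain {R : V → V → Prop} {x y : V} (h : Relation.ReflTransGen R x y) :
    ∃ l : List V, (y :: l).IsChain (fun a b => R b a) ∧ (y :: l).Nodup ∧
      (y :: l).getLast? = some x := by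
  induction h with
  | refl => exact ⟨[], by simp⟩
  | @tail y z _ hyz ih =>
    obtain ⟨l, hc, hnd, hx⟩ := ih
    by_cases hz : z ∈ y :: l
    · obtain ⟨s, t, hst⟩ := List.append_of_mem hz
      rw [hst] at hc hnd hx
      exact ⟨t, hc.right_of_append, hnd.of_append_right, by simpa using hx⟩
    · exact ⟨y :: l, List.isChain_cons_cons.2 ⟨hyz, hc⟩, List.nodup_cons.2 ⟨hz, hnd⟩,
        by simpa using hx⟩

theorem sum_sum_eq_zero_of_antisymm {s : Finset V} {F : V → V → ℤ} (hF : ∀ u v, F u v = - F v u) :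
    ∑ u ∈ s, ∑ v ∈ s, F u v = 0 := by
  have h : ∑ u ∈ s, ∑ v ∈ s, F u v = - ∑ u ∈ s, ∑ v ∈ s, F u v := by
    conv_lhs => rw [Finset.sum_comm]
    simp only [← Finset.sum_neg_distrib, ← hF]
  omega

/-- The total inflow into `A` of a finitely supported chain is its flux through the cut of `A`. -/
theorem sum_chainDiv_eq_sum_cut {h : V → V → ℤ} (hanti : ∀ u v, h u v = - h v u)
    (hfin : {p : V × V | h p.1 p.2 ≠ 0}.Finite) {U : Finset V} {A : Set V} {P : Finset (V × V)}
    (hU : ∀ v ∉ U, chainDiv h v = 0) (hPA : ∀ p ∈ P, p.1 ∉ A ∧ p.2 ∈ A)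
    (hP : ∀ u ∉ A, ∀ v ∈ A, h u v ≠ 0 → (u, v) ∈ P) :
    ∑ v ∈ U with v ∈ A, chainDiv h v = ∑ p ∈ P, h p.1 p.2 := by
  set W : Finset V := U ∪ hfin.toFinset.image Prod.fst ∪ P.image Prod.fst ∪ P.image Prod.snd
    with hW
  have hdiv : ∀ v, chainDiv h v = ∑ u ∈ W, h u v := fun v =>
    finsum_eq_sum_of_support_subset _ fun u hu => by
      have : u ∈ hfin.toFinset.image Prod.fst :=
        Finset.mem_image.2 ⟨(u, v), hfin.mem_toFinset.2 hu, rfl⟩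
      simp only [hW, Finset.coe_union, Set.mem_union, Finset.mem_coe]
      tauto
  calc ∑ v ∈ U with v ∈ A, chainDiv h v
      = ∑ v ∈ W with v ∈ A, chainDiv h v := by
        refine Finset.sum_subset (fun v hv => ?_) fun v hv hv' => hU v fun hvU => hv' ?_
        · rw [Finset.mem_filter] at hv ⊢
          refine ⟨?_, hv.2⟩
          simp only [hW, Finset.mem_union]
          tauto
        · exact Finset.mem_filter.2 ⟨hvU, (Finset.mem_filter.1 hv).2⟩
    _ = ∑ v ∈ W with v ∈ A, (∑ u ∈ W with u ∈ A, h u v + ∑ u ∈ W with u ∉ A, h u v) :=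
        Finset.sum_congr rfl fun v _ => by rw [hdiv, Finset.sum_filter_add_sum_filter_not]
    _ = ∑ v ∈ W with v ∈ A, ∑ u ∈ W with u ∉ A, h u v := by
        rw [Finset.sum_add_distrib,
          sum_sum_eq_zero_of_antisymm (F := fun v u => h u v) fun u v => hanti v u, zero_add]
    _ = ∑ p ∈ (W.filter (· ∉ A)) ×ˢ (W.filter (· ∈ A)), h p.1 p.2 := by
        rw [Finset.sum_product_right]
    _ = ∑ p ∈ P, h p.1 p.2 := by
        refine (Finset.sum_subset (fun p hp => ?_) fun p hp hpP => ?_).symm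
        · have h1 := Finset.mem_image_of_mem Prod.fst hp
          have h2 := Finset.mem_image_of_mem Prod.snd hp
          have h3 := hPA p hp
          simp only [Finset.mem_product, Finset.mem_filter, hW, Finset.mem_union]
          tauto
        · simp only [Finset.mem_product, Finset.mem_filter] at hp
          by_contra h0
          exact hpP (hP p.1 hp.1.2 p.2 hp.2.2 h0)

/-- A boundary has no flux through a finite cut. -/
theorem sum_cut_bd2_eq_zero {G : SimpleGraph V} {g : V → V → V → ℤ} (hg : IsChain2 G g)
    {A : Set V} {P : Finset (V × V)}
    (hP : ∀ p, p ∈ P ↔ G.Adj p.1 p.2 ∧ p.1 ∉ A ∧ p.2 ∈ A) :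
    ∑ p ∈ P, bd2 g p.1 p.2 = 0 := by
  obtain ⟨h12, h23, hadj⟩ := hg
  set B := P.image Prod.fst
  set C := P.image Prod.snd
  have hBC : Disjoint B C := by
    rw [Finset.disjoint_left]
    intro v hv hv'
    obtain ⟨p, hp, rfl⟩ := Finset.mem_image.1 hv
    obtain ⟨q, hq, hqp⟩ := Finset.mem_image.1 hv'
    exact ((hP p).1 hp).2.1 (hqp ▸ ((hP q).1 hq).2.2)
  have hbd : ∀ p ∈ P, bd2 g p.1 p.2 = ∑ w ∈ B ∪ C, g p.1 p.2 w := by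
    rintro ⟨u, v⟩ hp
    obtain ⟨-, hu, hv⟩ := (hP _).1 hp
    refine finsum_eq_sum_of_support_subset _ fun w hw => ?_
    obtain ⟨-, hvw, huw⟩ := hadj u v w hw
    by_cases hwA : w ∈ A
    · exact Finset.mem_union_right _ (Finset.mem_image.2 ⟨(u, w), (hP _).2 ⟨huw, hu, hwA⟩, rfl⟩)
    · exact Finset.mem_union_left _
        (Finset.mem_image.2 ⟨(w, v), (hP _).2 ⟨hvw.symm, hwA, hv⟩, rfl⟩)
  calc ∑ p ∈ P, bd2 g p.1 p.2 = ∑ p ∈ P, ∑ w ∈ B ∪ C, g p.1 p.2 w := Finset.sum_congr rfl hbd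
    _ = ∑ p ∈ B ×ˢ C, ∑ w ∈ B ∪ C, g p.1 p.2 w := by
        refine Finset.sum_subset (fun p hp => Finset.mem_product.2
          ⟨Finset.mem_image_of_mem _ hp, Finset.mem_image_of_mem _ hp⟩) fun p hp hpP => ?_
        obtain ⟨h1, h2⟩ := Finset.mem_product.1 hp
        obtain ⟨q, hq, hq'⟩ := Finset.mem_image.1 h1
        obtain ⟨r, hr, hr'⟩ := Finset.mem_image.1 h2
        refine Finset.sum_eq_zero fun w _ => by_contra fun hw => hpP ((hP p).2
          ⟨(hadj _ _ _ hw).1, hq' ▸ ((hP q).1 hq).2.1, hr' ▸ ((hP r).1 hr).2.2⟩)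
    _ = ∑ v ∈ C, ∑ u ∈ B, ∑ w ∈ B, g u v w + ∑ u ∈ B, ∑ v ∈ C, ∑ w ∈ C, g u v w := by
        simp only [Finset.sum_union hBC, Finset.sum_add_distrib]
        rw [Finset.sum_product_right, Finset.sum_product]
    _ = 0 := by
        rw [Finset.sum_eq_zero fun v _ => sum_sum_eq_zero_of_antisymm
            (F := fun u w => g u v w) fun u w => by rw [h12, h23, h12, neg_neg],
          Finset.sum_eq_zero fun u _ => sum_sum_eq_zero_of_antisymm
            (F := fun v w => g u v w) fun v w => h23 u v w, add_zero]

/-- If some unbalanced vertices remain, an admissible chain can be improved, provided that the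
prescribed values on `U` extend to a bounded chain which is a boundary. -/
theorem Admissible.exists_improvement {G : SimpleGraph V} {k : ℕ} {U : Finset V}
    {f fh h : V → V → ℤ} (hk : 0 < k) (hfh : Bdd fh k)
    (hbd : ∃ g, IsChain2 G g ∧ bd2 g = fh) (hext : ∀ u ∈ U, ∀ v ∈ U, fh u v = f u v)
    (hh : Admissible G k U f h) (hU : ∀ v ∉ U, chainDiv h v = 0) (hne : ∃ v, chainDiv h v ≠ 0) :
    ∃ h', Admissible G k U f h' ∧ (∀ v ∉ U, chainDiv h' v = 0) ∧
      ∑ v ∈ U, (chainDiv h' v).natAbs < ∑ v ∈ U, (chainDiv h v).natAbs := by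
  have htot : ∑ v ∈ U, chainDiv h v = 0 := by
    have := sum_chainDiv_eq_sum_cut (A := Set.univ) (P := ∅) hh.chain.1 hh.finite_support hU
      (by simp) (by simp)
    simpa using this
  obtain ⟨x₀, hx₀U, hx₀⟩ : ∃ x ∈ U, 0 < chainDiv h x := by
    obtain ⟨v, hv⟩ := hne
    have hvU : v ∈ U := by_contra fun h => hv (hU v h)
    exact Finset.exists_pos_of_sum_zero_of_exists_nonzero _ htot ⟨v, hvU, hv⟩
  set A : Set V := {v | ∃ x, 0 < chainDiv h x ∧ Relation.ReflTransGen (Residual G k U h) x v}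
  have hx₀A : x₀ ∈ A := ⟨x₀, hx₀, .refl⟩
  by_cases hneg : ∃ y ∈ A, chainDiv h y < 0
  · obtain ⟨y, ⟨x, hx, hxy⟩, hy⟩ := hneg
    obtain ⟨l, hc, hnd, hl⟩ := exists_nodup_chain hxy
    obtain ⟨h', hh', hdiv⟩ := hh.augment l hc hnd hl
    have hxU : x ∈ U := by_contra fun h => hx.ne' (hU x h)
    have hyU : y ∈ U := by_contra fun h => hy.ne (hU y h)
    have hxy' : x ≠ y := fun h => by rw [h] at hx; omega
    refine ⟨h', hh', fun v hv => ?_, Finset.sum_lt_sum (fun v _ => ?_) ⟨x, hxU, ?_⟩⟩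
    · have h1 : v ≠ x := fun h => hv (h ▸ hxU)
      have h2 : v ≠ y := fun h => hv (h ▸ hyU)
      simp [hdiv, hU v hv, unitMass, h1, h2]
    · by_cases h1 : v = x
      · subst h1
        simp only [hdiv, unitMass, hxy', if_true, if_false]
        omega
      · by_cases h2 : v = y
        · subst h2
          simp only [hdiv, unitMass, h1, if_true, if_false]
          omega
        · simp [hdiv, unitMass, h1, h2]
    · simp only [hdiv, unitMass, hxy', if_true, if_false]
      omega
  · exfalso
    push Not at hneg
    have hcut : ∀ u ∉ A, ∀ v ∈ A, G.Adj u v → h u v = -k ∨ u ∈ U ∧ v ∈ U := by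
      intro u hu v hv huv
      by_contra! hcon
      obtain ⟨x, hx, hxv⟩ := hv
      refine hu ⟨x, hx, hxv.tail ⟨huv.symm, ?_, fun h => hcon.2 h.2 h.1⟩⟩
      have h1 := abs_le.1 (hh.bdd u v)
      have h2 := hh.chain.1 u v
      have h3 := hcon.1
      omega
    have hPfin : {p : V × V | G.Adj p.1 p.2 ∧ p.1 ∉ A ∧ p.2 ∈ A}.Finite := by
      refine (hh.finite_support.union (U ×ˢ U).finite_toSet).subset ?_
      rintro ⟨u, v⟩ ⟨huv, hu, hv⟩
      rcases hcut u hu v hv huv with h1 | h1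
      · left
        simp only [Set.mem_ofPred_eq, h1]
        omega
      · right
        simpa using h1
    have hmem : ∀ p, p ∈ hPfin.toFinset ↔ G.Adj p.1 p.2 ∧ p.1 ∉ A ∧ p.2 ∈ A := fun p => by simp
    have hflux := sum_chainDiv_eq_sum_cut (A := A) (P := hPfin.toFinset) hh.chain.1
      hh.finite_support hU (fun p hp => ((hmem p).1 hp).2)
      (fun u hu v hv huv => (hmem _).2 ⟨hh.chain.2 u v huv, hu, hv⟩)
    have hpos : 0 < ∑ v ∈ U with v ∈ A, chainDiv h v :=
      Finset.sum_pos' (fun v hv => hneg v (Finset.mem_filter.1 hv).2)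
        ⟨x₀, Finset.mem_filter.2 ⟨hx₀U, hx₀A⟩, hx₀⟩
    obtain ⟨g, hg, rfl⟩ := hbd
    have hle : ∑ p ∈ hPfin.toFinset, h p.1 p.2 ≤ ∑ p ∈ hPfin.toFinset, bd2 g p.1 p.2 := by
      refine Finset.sum_le_sum fun p hp => ?_
      obtain ⟨h1, h2, h3⟩ := (hmem p).1 hp
      rcases hcut _ h2 _ h3 h1 with h4 | ⟨h4, h5⟩
      · rw [h4]
        exact (abs_le.1 (hfh _ _)).1
      · rw [hh.agree _ h4 _ h5, hext _ h4 _ h5]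
    rw [sum_cut_bd2_eq_zero hg hmem] at hle
    omega

/-- A finite piece of a bounded boundary extends to a finitely supported flow with the same
bound. -/
theorem exists_finite_flow {G : SimpleGraph V} {k : ℕ} {U : Finset V} {f fh : V → V → ℤ}
    (hf : IsChain1 G f) (hfU : ∀ u v, f u v ≠ 0 → u ∈ U ∧ v ∈ U) (hfk : Bdd f k)
    (hfh : Bdd fh k) (hbd : ∃ g, IsChain2 G g ∧ bd2 g = fh)
    (hext : ∀ u ∈ U, ∀ v ∈ U, fh u v = f u v) :
    ∃ h, Admissible G k U f h ∧ ∀ v, chainDiv h v = 0 := by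
  have hfadm : Admissible G k U f f :=
    ⟨hf, hfk, (U ×ˢ U).finite_toSet.subset fun p hp => by simpa using hfU _ _ hp, fun _ _ _ _ => rfl⟩
  rcases Nat.eq_zero_or_pos k with rfl | hk
  · have h0 : ∀ u v, f u v = 0 := fun u v => by simpa using hfk u v
    exact ⟨f, hfadm, fun v => by simp [chainDiv, h0]⟩
  suffices H : ∀ n : ℕ, ∀ h, Admissible G k U f h → (∀ v ∉ U, chainDiv h v = 0) →
      ∑ v ∈ U, (chainDiv h v).natAbs = n → ∃ h, Admissible G k U f h ∧ ∀ v, chainDiv h v = 0 by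
    refine H _ f hfadm (fun v hv => ?_) rfl
    refine finsum_eq_zero_of_forall_eq_zero fun u => ?_
    by_contra h
    exact hv (hfU u v h).2
  intro n
  induction n using Nat.strong_induction_on with
  | _ n ih =>
    intro h hh hU hn
    by_cases hne : ∃ v, chainDiv h v ≠ 0
    · obtain ⟨h', hh', hU', hlt⟩ := hh.exists_improvement hk hfh hbd hext hU hne
      exact ih _ (hn ▸ hlt) h' hh' hU' rfl
    · exact ⟨h, hh, by simpa using hne⟩

theorem finite_automorphism_images {G : SimpleGraph V} (hlf : ∀ v, (G.neighborSet v).Finite)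
    {o s : V} (p : G.Walk o s) (t : V) : {v | ∃ φ : G ≃g G, φ s = t ∧ φ o = v}.Finite := by
  induction p with
  | nil => exact (Set.finite_singleton t).subset fun v ⟨φ, h1, h2⟩ => h2.symm.trans h1
  | cons hadj p ih =>
    refine (ih.biUnion fun v _ => hlf v).subset ?_
    rintro v ⟨φ, h1, rfl⟩
    exact Set.mem_biUnion ⟨φ, h1, rfl⟩ (φ.map_adj_iff.2 hadj.symm)

/-- Some automorphism moves `S` off `T`. -/
theorem exists_disjoint_translate {G : SimpleGraph V} [Infinite V] (hconn : G.Connected)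
    (htrans : VertexTransitive G) (hlf : ∀ v, (G.neighborSet v).Finite) (S T : Finset V) :
    ∃ φ : G ≃g G, ∀ s ∈ S, φ s ∉ T := by
  obtain ⟨o⟩ := hconn.nonempty
  have hfin : (⋃ s ∈ S, ⋃ t ∈ T, {v | ∃ φ : G ≃g G, φ s = t ∧ φ o = v}).Finite :=
    S.finite_toSet.biUnion fun s _ => T.finite_toSet.biUnion fun t _ =>
      finite_automorphism_images hlf (hconn o s).some t
  obtain ⟨v, hv⟩ := hfin.exists_notMem
  obtain ⟨φ, hφ⟩ := htrans o v
  refine ⟨φ, fun s hs ht => hv ?_⟩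
  simp only [Set.mem_iUnion]
  exact ⟨s, hs, φ s, ht, φ, rfl, hφ⟩

/-- Finite sets indexed by `ℕ` have, for infinitely many indices, pairwise disjoint translates. -/
theorem exists_pairwise_disjoint_translates {G : SimpleGraph V} [Infinite V]
    (hconn : G.Connected) (htrans : VertexTransitive G) (hlf : ∀ v, (G.neighborSet v).Finite)
    (S : ℕ → Finset V) :
    ∃ (N : ℕ → ℕ) (φ : ℕ → G ≃g G), StrictMono N ∧
      ∀ i j, i ≠ j → ∀ u ∈ S (N i), ∀ v ∈ S (N j), φ i u ≠ φ j v := by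
  obtain ⟨F, -, hF⟩ := exists_seq_of_forall_finset_exists (α := ℕ × (G ≃g G)) (fun _ => True)
    (fun x y => x.1 < y.1 ∧ ∀ u ∈ S x.1, ∀ v ∈ S y.1, x.2 u ≠ y.2 v) fun s _ => by
      obtain ⟨φ, hφ⟩ := exists_disjoint_translate hconn htrans hlf (S (s.sup Prod.fst + 1))
        (s.biUnion fun x => (S x.1).image x.2)
      refine ⟨(s.sup Prod.fst + 1, φ), trivial, fun x hx => ⟨Nat.lt_succ_of_le
        (Finset.le_sup (f := Prod.fst) hx), fun u hu v hv huv => hφ v hv ?_⟩⟩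
      exact Finset.mem_biUnion.2 ⟨x, hx, Finset.mem_image.2 ⟨u, hu, huv⟩⟩
  refine ⟨fun i => (F i).1, fun i => (F i).2, strictMono_nat_of_lt_succ fun i =>
    (hF i (i + 1) i.lt_succ_self).1, fun i j hij u hu v hv => ?_⟩
  rcases hij.lt_or_gt with h | h
  · exact (hF i j h).2 u hu v hv
  · exact ((hF j i h).2 v hv u hu).symm

/-- Uniformly bounded flows supported on pairwise disjoint sets add up to a bounded flow. -/
theorem exists_glued_flow {G : SimpleGraph V} {k : ℕ} (T : ℕ → Set V) (H : ℕ → V → V → ℤ)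
    (hT : ∀ i j, ∀ v ∈ T i, v ∈ T j → i = j) (hchain : ∀ i, IsChain1 G (H i))
    (hbdd : ∀ i, Bdd (H i) k) (hdiv : ∀ i v, chainDiv (H i) v = 0)
    (hsupp : ∀ i u v, H i u v ≠ 0 → v ∈ T i) :
    ∃ z ∈ Zsuf1 G, ∀ i, ∀ v ∈ T i, ∀ u, z u v = H i u v := by
  set z : V → V → ℤ := fun u v => if h : ∃ i, v ∈ T i then H h.choose u v else 0 with hz
  have hzT : ∀ i, ∀ v ∈ T i, ∀ u, z u v = H i u v := by
    intro i v hv u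
    have h : ∃ i, v ∈ T i := ⟨i, hv⟩
    simp only [hz, dif_pos h]
    rw [hT _ _ v h.choose_spec hv]
  have hz0 : ∀ v, (∀ i, v ∉ T i) → ∀ u, z u v = 0 := fun v hv u => dif_neg fun ⟨i, h⟩ => hv i h
  have hsymm : ∀ i, ∀ v ∈ T i, ∀ u, z v u = - z u v := by
    intro i v hv u
    rw [hzT i v hv u, ← (hchain i).1 v u]
    by_cases hu : u ∈ T i
    · exact hzT i u hu v
    · have h0 : H i v u = 0 := by_contra fun h => hu (hsupp i v u h)
      rw [h0]
      by_cases hu' : ∃ j, u ∈ T j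
      · obtain ⟨j, hj⟩ := hu'
        rw [hzT j u hj v, (hchain j).1, neg_eq_zero]
        exact by_contra fun h => hu ((hT i j v hv (hsupp j u v h)) ▸ hj)
      · exact hz0 u (by simpa using hu') v
  refine ⟨z, ⟨⟨fun u v => ?_, fun u v huv => ?_⟩, ⟨k, fun u v => ?_⟩, fun v => ?_⟩, hzT⟩
  · by_cases hv : ∃ i, v ∈ T i
    · obtain ⟨i, hi⟩ := hv
      rw [hsymm i v hi u, neg_neg]
    · by_cases hu : ∃ i, u ∈ T i
      · obtain ⟨i, hi⟩ := hu
        exact hsymm i u hi v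
      · rw [hz0 v (by simpa using hv), hz0 u (by simpa using hu), neg_zero]
  all_goals
    by_cases hv : ∃ i, v ∈ T i
    · obtain ⟨i, hi⟩ := hv
      have hrow := hzT i v hi
      first
        | exact (hchain i).2 u v (hrow u ▸ huv)
        | exact hrow u ▸ hbdd i u v
        | simpa only [chainDiv, hrow] using hdiv i v
    · have hrow := hz0 v (by simpa using hv)
      first
        | exact absurd (hrow u) huv
        | simp [hrow]
        | simp [chainDiv, hrow]

theorem chainDiv_comp_equiv (f : V → V → ℤ) (φ : V ≃ V) (v : V) :
    chainDiv (fun a b => f (φ a) (φ b)) v = chainDiv f (φ v) :=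
  finsum_comp_equiv φ (f := fun u => f u (φ v))

/-- for infinite vertex-transitive graphs, vanishing of
H^suf_1(X,ℤ) implies H^suf_1-expansion. -/
theorem stmt17 (G : SimpleGraph V) (hinf : Infinite V) (hconn : G.Connected)
    (htrans : VertexTransitive G) (hulf : ULF G)
    (hvanish : ∀ f ∈ Zsuf1 G,
      ∃ g : V → V → V → ℤ, IsChain2 G g ∧ (∃ C, Bdd2 g C) ∧ bd2 g = f) :
    HsufExp1 G := by
  obtain ⟨D, hD⟩ := hulf
  have hlf : ∀ v, (G.neighborSet v).Finite := fun v => (hD v).1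
  unfold HsufExp1
  suffices H : ∀ k : ℕ, ∃ n : ℕ, ∀ (U : Finset V) (f h : V → V → ℤ), Admissible G k U f h →
      (∀ v, chainDiv h v = 0) → ∃ g : V → V → V → ℤ, IsChain2 G g ∧ Bdd2 g n ∧
        ∀ u ∈ U, ∀ v ∈ U, bd2 g u v = f u v by
    choose K hK using H
    refine ⟨K, fun U f hf hfU _ ⟨fh, hfh, hext, hnorm⟩ => ?_⟩
    obtain ⟨g, hg, -, hgf⟩ := hvanish fh hfh
    have hfk : Bdd f (chainNorm f) := bdd_chainNorm <| exists_bdd_of_finite_support <|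
      (U ×ˢ U).finite_toSet.subset fun p hp => by simpa using hfU _ _ hp
    obtain ⟨h, hh, hdiv⟩ := exists_finite_flow hf hfU hfk (hnorm ▸ bdd_chainNorm hfh.2.1)
      ⟨g, hg, hgf⟩ hext
    exact hK _ U f h hh hdiv
  intro k
  by_contra! hcon
  choose U f h hh hdiv hbad using hcon
  set S : ℕ → Finset V := fun n => U n ∪ (hh n).finite_support.toFinset.image Prod.snd
  obtain ⟨N, φ, hN, hdisj⟩ := exists_pairwise_disjoint_translates hconn htrans hlf S
  obtain ⟨z, hz, hzT⟩ := exists_glued_flow (G := G) (k := k)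
    (fun i => (φ i) '' (S (N i) : Set V))
    (fun i u v => h (N i) ((φ i).symm u) ((φ i).symm v))
    (by
      rintro i j _ ⟨u, hu, rfl⟩ ⟨v, hv, huv⟩
      exact by_contra fun hij => hdisj i j hij u hu v hv huv.symm)
    (fun i => ⟨fun u v => (hh (N i)).chain.1 _ _, fun u v huv =>
      (φ i).symm.map_adj_iff.1 ((hh (N i)).chain.2 _ _ huv)⟩)
    (fun i u v => (hh (N i)).bdd _ _)
    (fun i v => (chainDiv_comp_equiv (h (N i)) (φ i).symm.toEquiv v).trans (hdiv _ _))
    (fun i u v huv => ⟨(φ i).symm v, Finset.mem_coe.2 (Finset.mem_union_right _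
      (Finset.mem_image.2 ⟨((φ i).symm u, (φ i).symm v),
        (hh (N i)).finite_support.mem_toFinset.2 huv, rfl⟩)), (φ i).apply_symm_apply v⟩)
  obtain ⟨g, ⟨h12, h23, hadj⟩, ⟨C, hC⟩, rfl⟩ := hvanish z hz
  obtain ⟨u, hu, v, hv, huv⟩ := hbad (N C) (fun a b c => g (φ C a) (φ C b) (φ C c))
    ⟨fun _ _ _ => h12 _ _ _, fun _ _ _ => h23 _ _ _, fun a b c habc => by
      simpa only [(φ C).map_adj_iff] using hadj _ _ _ habc⟩
    (fun a b c => (hC _ _ _).trans (by exact_mod_cast hN.id_le C))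
  refine huv ?_
  have hbd : bd2 (fun a b c => g (φ C a) (φ C b) (φ C c)) u v = bd2 g (φ C u) (φ C v) :=
    finsum_comp_equiv (φ C).toEquiv (f := fun w => g (φ C u) (φ C v) w)
  rw [hbd, hzT C _ ⟨v, Finset.mem_coe.2 (Finset.mem_union_left _ hv), rfl⟩]
  simpa using (hh (N C)).agree u hu v hv

end UFH
end

section
/- Let X be a connected, one-ended, uniformly locally finite graph (for every finite K ⊆ V(X), the graph X − K has exactly one infinite connected component). Let U ⊆ V(X) be finite and let f be a 1-chain supported on E(U) whose divergence vanishes at every vertex of U ∖ ∂U, and suppose f admits an extension f̂ ∈ Z^suf_1(X,ℤ) with f̂ agreeing with f on E(U) and ‖f̂‖ = ‖f‖. Then f admits an extension g ∈ Z^suf_1(X,ℤ) agreeing with f on E(U) and having finite support. -/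
open scoped Classical

namespace UFH

variable {V : Type}

/-- `d` is the divergence of a finitely supported 1-chain carried by edges avoiding `K`. -/
def IsFiniteDivAvoiding (G : SimpleGraph V) (K : Set V) (d : V → ℤ) : Prop :=
  ∃ h : V → V → ℤ, IsChain1 G h ∧
    (∃ T : Finset V, ∀ u v, h u v ≠ 0 → u ∈ T ∧ v ∈ T) ∧
    (∀ u v, h u v ≠ 0 → u ∉ K ∧ v ∉ K) ∧ ∀ v, chainDiv h v = d v

theorem chainDiv_eq_sum {h : V → V → ℤ} {T : Finset V}
    (hT : ∀ u v, h u v ≠ 0 → u ∈ T ∧ v ∈ T) (v : V) : chainDiv h v = ∑ u ∈ T, h u v :=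
  finsum_eq_sum_of_support_subset _ fun u hu => (hT u v hu).1

theorem chainDiv_add_s18 {g h : V → V → ℤ} {S T : Finset V}
    (hS : ∀ u v, g u v ≠ 0 → u ∈ S ∧ v ∈ S) (hT : ∀ u v, h u v ≠ 0 → u ∈ T ∧ v ∈ T) (v : V) :
    chainDiv (fun u v => g u v + h u v) v = chainDiv g v + chainDiv h v :=
  finsum_add_distrib (S.finite_toSet.subset fun u hu => (hS u v hu).1)
    (T.finite_toSet.subset fun u hu => (hT u v hu).1)

theorem IsChain1.add {G : SimpleGraph V} {g h : V → V → ℤ} (hg : IsChain1 G g)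
    (hh : IsChain1 G h) : IsChain1 G (fun u v => g u v + h u v) := by
  refine ⟨fun u v => ?_, fun u v huv => ?_⟩
  · have := hg.1 u v
    have := hh.1 u v
    dsimp only
    omega
  · by_cases h0 : g u v = 0
    · exact hh.2 u v (by simpa [h0] using huv)
    · exact hg.2 u v h0

theorem add_finsupp {g h : V → V → ℤ} {S T : Finset V}
    (hS : ∀ u v, g u v ≠ 0 → u ∈ S ∧ v ∈ S) (hT : ∀ u v, h u v ≠ 0 → u ∈ T ∧ v ∈ T) (u v : V)
    (huv : g u v + h u v ≠ 0) : u ∈ S ∪ T ∧ v ∈ S ∪ T := by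
  by_cases h0 : g u v = 0
  · have := hT u v (by simpa [h0] using huv)
    simp [this]
  · simp [hS u v h0]

theorem bdd_of_finsupp {h : V → V → ℤ} {T : Finset V}
    (hT : ∀ u v, h u v ≠ 0 → u ∈ T ∧ v ∈ T) : ∃ C, Bdd h C := by
  refine ⟨(T ×ˢ T).sup fun e => (h e.1 e.2).natAbs, fun u v => ?_⟩
  by_cases h0 : h u v = 0
  · simp [h0]
  · have := Finset.le_sup (f := fun e : V × V => (h e.1 e.2).natAbs)
      (Finset.mem_product.2 (hT u v h0) : (u, v) ∈ T ×ˢ T)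
    rw [Int.abs_eq_natAbs]
    exact_mod_cast this

theorem sum_chainDiv_eq_zero {G : SimpleGraph V} {h : V → V → ℤ} {T : Finset V}
    (hh : IsChain1 G h) (hT : ∀ u v, h u v ≠ 0 → u ∈ T ∧ v ∈ T) :
    ∑ v ∈ T, chainDiv h v = 0 := by
  have key : ∑ v ∈ T, ∑ u ∈ T, h u v = - ∑ v ∈ T, ∑ u ∈ T, h u v := by
    conv_lhs => rw [Finset.sum_comm]
    simp only [← Finset.sum_neg_distrib]
    exact Finset.sum_congr rfl fun v _ => Finset.sum_congr rfl fun u _ => hh.1 v u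
  simp only [chainDiv_eq_sum hT]
  omega

namespace IsFiniteDivAvoiding

variable {G : SimpleGraph V} {K : Set V}

protected theorem zero : IsFiniteDivAvoiding G K 0 :=
  ⟨fun _ _ => 0, ⟨by simp, by simp⟩, ⟨∅, by simp⟩, by simp, by simp [chainDiv]⟩

protected theorem add {d e : V → ℤ} (hd : IsFiniteDivAvoiding G K d)
    (he : IsFiniteDivAvoiding G K e) : IsFiniteDivAvoiding G K (d + e) := by
  obtain ⟨g, hg, ⟨S, hS⟩, hgK, hgd⟩ := hd
  obtain ⟨h, hh, ⟨T, hT⟩, hhK, hhd⟩ := he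
  refine ⟨_, hg.add hh, ⟨S ∪ T, add_finsupp hS hT⟩, fun u v huv => ?_, fun v => ?_⟩
  · by_cases h0 : g u v = 0
    · exact hhK u v (by simpa [h0] using huv)
    · exact hgK u v h0
  · rw [chainDiv_add_s18 hS hT, hgd, hhd, Pi.add_apply]

protected theorem smul {d : V → ℤ} (n : ℤ) (hd : IsFiniteDivAvoiding G K d) :
    IsFiniteDivAvoiding G K (n • d) := by
  obtain ⟨g, hg, ⟨S, hS⟩, hgK, hgd⟩ := hd
  refine ⟨fun u v => n * g u v, ⟨fun u v => ?_, fun u v huv => hg.2 u v (right_ne_zero_of_mul huv)⟩,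
    ⟨S, fun u v huv => hS u v (right_ne_zero_of_mul huv)⟩,
    fun u v huv => hgK u v (right_ne_zero_of_mul huv), fun v => ?_⟩
  · dsimp only
    rw [hg.1 u v, mul_neg]
  · rw [Pi.smul_apply, ← hgd v, smul_eq_mul]
    exact (mul_finsum _ _).symm

protected theorem sum {ι : Type*} {d : ι → V → ℤ} (s : Finset ι)
    (hd : ∀ i ∈ s, IsFiniteDivAvoiding G K (d i)) : IsFiniteDivAvoiding G K (∑ i ∈ s, d i) :=
  Finset.sum_induction _ _ (fun _ _ => .add) .zero hd

theorem of_adj {a b : V} (hab : G.Adj a b) (ha : a ∉ K) (hb : b ∉ K) :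
    IsFiniteDivAvoiding G K (Pi.single a 1 - Pi.single b 1) := by
  have hne := hab.ne
  have hT : ∀ u v : V, ((if u = b ∧ v = a then 1 else 0) - (if u = a ∧ v = b then 1 else 0) : ℤ) ≠ 0
      → (u = b ∧ v = a) ∨ (u = a ∧ v = b) := by
    intro u v huv
    by_contra! hc
    exact huv (by rw [if_neg (by tauto), if_neg (by tauto), sub_zero])
  have hT' : ∀ u v : V,
      ((if u = b ∧ v = a then 1 else 0) - (if u = a ∧ v = b then 1 else 0) : ℤ) ≠ 0
      → u ∈ ({a, b} : Finset V) ∧ v ∈ ({a, b} : Finset V) := by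
    intro u v huv
    rcases hT u v huv with ⟨rfl, rfl⟩ | ⟨rfl, rfl⟩ <;> simp
  refine ⟨fun u v => (if u = b ∧ v = a then 1 else 0) - (if u = a ∧ v = b then 1 else 0),
    ⟨fun u v => ?_, fun u v huv => ?_⟩, ⟨{a, b}, hT'⟩, fun u v huv => ?_, fun v => ?_⟩
  · simp only [and_comm (a := v = b), and_comm (a := v = a)]
    ring
  · rcases hT u v huv with ⟨rfl, rfl⟩ | ⟨rfl, rfl⟩
    exacts [hab.symm, hab]
  · rcases hT u v huv with ⟨rfl, rfl⟩ | ⟨rfl, rfl⟩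
    exacts [⟨hb, ha⟩, ⟨ha, hb⟩]
  · rw [chainDiv_eq_sum hT', Finset.sum_pair hne]
    simp [hne, hne.symm, Pi.single_apply]
    ring

theorem of_walk {a b : V} (p : G.Walk a b) (hp : ∀ v ∈ p.support, v ∉ K) :
    IsFiniteDivAvoiding G K (Pi.single a 1 - Pi.single b 1) := by
  induction p with
  | nil => simpa using IsFiniteDivAvoiding.zero
  | cons hab q ih =>
    have hq : ∀ v ∈ q.support, v ∉ K := fun v hv => hp v (by simp [hv])
    simpa using (of_adj hab (hp _ (by simp)) (hq _ (by simp))).add (ih hq)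

/-- A finitely supported function of total zero on a component of `G - K` is a divergence. -/
theorem of_sum_eq_zero {c : V} {d : V → ℤ} {T : Finset V} (hT : ∀ v, d v ≠ 0 → v ∈ T)
    (hc : ∀ v, d v ≠ 0 → ConnAvoiding G K v c) (h0 : ∑ v ∈ T, d v = 0) :
    IsFiniteDivAvoiding G K d := by
  have hd : d = ∑ v ∈ T, d v • (Pi.single v 1 - Pi.single c 1 : V → ℤ) := by
    simp only [smul_sub, Finset.sum_sub_distrib, ← Finset.sum_smul, h0, zero_smul, sub_zero]
    ext w
    by_cases hw : w ∈ T
    · simp [Finset.sum_apply, Pi.single_apply, hw]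
    · simp [Finset.sum_apply, Pi.single_apply, hw, not_imp_comm.1 (hT w) hw]
  rw [hd]
  refine .sum T fun v _ => ?_
  by_cases hv : d v = 0
  · simpa [hv] using IsFiniteDivAvoiding.zero
  · obtain ⟨p, hp⟩ := hc v hv
    exact (of_walk p hp).smul _

end IsFiniteDivAvoiding

theorem exists_adj_of_walk {G : SimpleGraph V} {K : Set V} {a c : V} (p : G.Walk a c) :
    a ∈ K ∨ ConnAvoiding G K a c ∨
      ∃ x y, x ∉ K ∧ y ∈ K ∧ G.Adj y x ∧ ConnAvoiding G K a x := by
  induction p with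
  | @nil u =>
    by_cases hu : u ∈ K
    · exact .inl hu
    · exact .inr (.inl ⟨.nil, by simpa using hu⟩)
  | @cons u v w h q ih =>
    by_cases hu : u ∈ K
    · exact .inl hu
    rcases ih with hv | ⟨r, hr⟩ | ⟨x, y, hx, hy, hyx, r, hr⟩
    · exact .inr (.inr ⟨u, v, hu, hv, h.symm, .nil, by simpa using hu⟩)
    · exact .inr (.inl ⟨.cons h r, by simpa [hu] using hr⟩)
    · exact .inr (.inr ⟨x, y, hx, hy, hyx, .cons h r, by simpa [hu] using hr⟩)

theorem ConnAvoiding.trans {G : SimpleGraph V} {K : Set V} {a b c : V}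
    (hab : ConnAvoiding G K a b) (hbc : ConnAvoiding G K b c) : ConnAvoiding G K a c := by
  obtain ⟨p, hp⟩ := hab
  obtain ⟨q, hq⟩ := hbc
  refine ⟨p.append q, fun v hv => ?_⟩
  rcases (SimpleGraph.Walk.mem_support_append_iff p q).1 hv with hv | hv
  exacts [hp v hv, hq v hv]

/-- If the component of `c` is the only infinite component of `G - K`, it is cofinite. -/
theorem finite_not_connAvoiding {G : SimpleGraph V} (hfin : ∀ v, (G.neighborSet v).Finite)
    (hconn : G.Connected) (K : Finset V) {c : V}
    (hc : ∀ u, u ∉ K → (Component G (↑K) u).Infinite → ConnAvoiding G (↑K) u c) :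
    {v | ¬ ConnAvoiding G (↑K) v c}.Finite := by
  let N : Set V := {x | (∃ y ∈ K, G.Adj y x) ∧ x ∉ K ∧ ¬ ConnAvoiding G (↑K) x c}
  have hN : N.Finite := by
    refine (K.finite_toSet.biUnion fun y _ => hfin y).subset ?_
    rintro x ⟨⟨y, hy, hyx⟩, -⟩
    exact Set.mem_biUnion (Finset.mem_coe.2 hy) hyx
  have hcomp : ∀ x ∈ N, (Component G (↑K) x).Finite := fun x hx =>
    Set.not_infinite.1 fun h => hx.2.2 (hc x hx.2.1 h)
  refine (K.finite_toSet.union (hN.biUnion hcomp)).subset fun v hv => ?_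
  obtain ⟨p⟩ := hconn.preconnected v c
  rcases exists_adj_of_walk (K := (↑K : Set V)) p with h | h | ⟨x, y, hx, hy, hyx, h⟩
  · exact .inl h
  · exact absurd h hv
  · refine .inr (Set.mem_biUnion (x := x) ⟨⟨y, hy, hyx⟩, hx, fun hxc => hv (h.trans hxc)⟩ ⟨?_, h⟩)
    obtain ⟨r, hr⟩ := h
    exact hr v (by simp)

/-- in a one-ended graph, extensible local cycles admit finitely
supported extensions. -/
theorem stmt18 (G : SimpleGraph V) (hulf : ULF G) (hconn : G.Connected)
    (hone : OneEnded G)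
    (U : Finset V) (f : V → V → ℤ) (hf : IsChain1 G f)
    (hsupp : ∀ u v, f u v ≠ 0 → u ∈ U ∧ v ∈ U)
    (hdiv : ∀ v ∈ U, (∀ u, G.Adj u v → u ∈ U) → chainDiv f v = 0)
    (hext : ∃ fh ∈ Zsuf1 G, (∀ u ∈ U, ∀ v ∈ U, fh u v = f u v) ∧
      chainNorm fh = chainNorm f) :
    ∃ g ∈ Zsuf1 G, (∀ u ∈ U, ∀ v ∈ U, g u v = f u v) ∧
      {e : V × V | g e.1 e.2 ≠ 0}.Finite := by
  obtain ⟨D, hD⟩ := hulf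
  obtain ⟨fh, ⟨hfh, -, hfh0⟩, hfhf, -⟩ := hext
  obtain ⟨c, -, -, hc⟩ := hone.2 U
  have hfin := finite_not_connAvoiding (fun v => (hD v).1) hconn U hc
  let C : Set V := {v | ConnAvoiding G (↑U) v c}
  have hCU : ∀ v ∈ C, v ∉ U := by
    rintro v ⟨p, hp⟩
    exact hp v (by simp)
  let g₀ : V → V → ℤ := fun u v => if u ∈ C ∧ v ∈ C then 0 else fh u v
  have hg₀ : IsChain1 G g₀ := by
    refine ⟨fun u v => ?_, fun u v huv => hfh.2 u v fun h => huv ?_⟩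
    · simp only [g₀, and_comm (a := v ∈ C)]
      split_ifs
      · simp
      · exact hfh.1 u v
    · simp [g₀, h]
  have hS : ∃ S : Finset V, ∀ u v, g₀ u v ≠ 0 → u ∈ S ∧ v ∈ S := by
    have hfin' := hfin.union (hfin.biUnion fun y _ => (hD y).1)
    refine ⟨hfin'.toFinset, fun u v huv => ?_⟩
    have hadj := hg₀.2 u v huv
    have hnot : ¬ (u ∈ C ∧ v ∈ C) := fun h => huv (if_pos h)
    simp only [Set.Finite.mem_toFinset]
    by_cases hu : u ∈ C
    · have hv : v ∉ C := fun hv => hnot ⟨hu, hv⟩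
      exact ⟨.inr (Set.mem_biUnion (x := v) hv hadj.symm), .inl hv⟩
    · by_cases hv : v ∈ C
      · exact ⟨.inl hu, .inr (Set.mem_biUnion (x := u) hu hadj)⟩
      · exact ⟨.inl hu, .inl hv⟩
  obtain ⟨S, hS⟩ := hS
  have hdiv₀ : ∀ v, v ∉ C → chainDiv g₀ v = 0 := by
    intro v hv
    rw [← hfh0 v]
    simp [chainDiv, g₀, hv]
  have hdS : ∀ v, chainDiv g₀ v ≠ 0 → v ∈ S := by
    intro v hv
    rw [chainDiv_eq_sum hS] at hv
    obtain ⟨u, -, hu⟩ := Finset.exists_ne_zero_of_sum_ne_zero hv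
    exact (hS u v hu).2
  obtain ⟨h, hh, ⟨T, hT⟩, hhU, hhd⟩ :=
    IsFiniteDivAvoiding.of_sum_eq_zero (G := G) (K := ↑U) (c := c)
      (d := fun v => - chainDiv g₀ v) (T := S) (fun v hv => hdS v (neg_ne_zero.1 hv))
      (fun v hv => by_contra fun hvC => neg_ne_zero.1 hv (hdiv₀ v hvC))
      (by rw [Finset.sum_neg_distrib, sum_chainDiv_eq_zero hg₀ hS, neg_zero])
  refine ⟨fun u v => g₀ u v + h u v,
    ⟨hg₀.add hh, bdd_of_finsupp (add_finsupp hS hT), fun v => ?_⟩, fun u hu v hv => ?_, ?_⟩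
  · rw [chainDiv_add_s18 hS hT, hhd, add_neg_cancel]
  · have h1 : g₀ u v = fh u v := if_neg fun hC => hCU u hC.1 hu
    have h2 : h u v = 0 := by_contra fun h0 => (hhU u v h0).1 hu
    dsimp only
    rw [h1, h2, add_zero, hfhf u hu v hv]
  · refine ((S ∪ T) ×ˢ (S ∪ T)).finite_toSet.subset fun e he => ?_
    exact Finset.mem_coe.2 (Finset.mem_product.2 (add_finsupp hS hT e.1 e.2 he))

end UFH
end
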